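/- Let X be a nonempty finite type, p a probability mass function on X with full support, and E : X → ℝ. Write μ = Σ_x p(x)·exp(−E(x)) and A = log μ, and assume the random variable exp(−E(X)) for X ~ p is not almost surely constant (i.e., its variance μ₂ = Σ_x p(x)·exp(−2E(x)) − μ² is strictly positive). For i.i.d. random variables X_1, X_2, … with law p, define T_n = log((1/n)·Σ_{i=1}^n exp(−E(X_i))). Then for every ε > 0 there exists N > 0 such that for all n > N: A − ε < 𝔼[T_n] < A < 𝔼[(2n−1)·T_n − 2(n−1)·T_{n−1}] < A + ε. -/

import Mathlib

/-- The expectation of `F` under `n` independent draws from the weights `p`. -/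
noncomputable def iidMean {X : Type*} [Fintype X] (p : X → ℝ) (n : ℕ) (F : (Fin n → X) → ℝ) : ℝ :=
  ∑ ω : Fin n → X, (∏ i, p (ω i)) * F ω

section iidMean

variable {X : Type*} [Fintype X] {p : X → ℝ}

theorem iidMean_add (n : ℕ) (F G : (Fin n → X) → ℝ) :
    iidMean p n (fun ω => F ω + G ω) = iidMean p n F + iidMean p n G := by
  simp only [iidMean, mul_add, Finset.sum_add_distrib]

theorem iidMean_sum {ι : Type*} (s : Finset ι) (n : ℕ) (F : ι → (Fin n → X) → ℝ) :
    iidMean p n (fun ω => ∑ j ∈ s, F j ω) = ∑ j ∈ s, iidMean p n (F j) := by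
  simp only [iidMean, Finset.mul_sum]
  exact Finset.sum_comm

theorem iidMean_const_mul (n : ℕ) (c : ℝ) (F : (Fin n → X) → ℝ) :
    iidMean p n (fun ω => c * F ω) = c * iidMean p n F := by
  simp only [iidMean, Finset.mul_sum]
  exact Finset.sum_congr rfl fun ω _ => by ring

theorem iidMean_one (hsum : ∑ x, p x = 1) (n : ℕ) : iidMean p n (fun _ => 1) = 1 := by
  simp only [iidMean, mul_one, ← Fintype.sum_pow, hsum, one_pow]

theorem abs_iidMean_le (hp : ∀ x, 0 ≤ p x) (n : ℕ) {F G : (Fin n → X) → ℝ}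
    (h : ∀ ω, |F ω| ≤ G ω) : |iidMean p n F| ≤ iidMean p n G := by
  refine (Finset.abs_sum_le_sum_abs _ _).trans (Finset.sum_le_sum fun ω _ => ?_)
  have hω : 0 ≤ ∏ i, p (ω i) := Finset.prod_nonneg fun i _ => hp _
  rw [abs_mul, abs_of_nonneg hω]
  exact mul_le_mul_of_nonneg_left (h ω) hω

theorem iidMean_succ (n : ℕ) (F : (Fin (n + 1) → X) → ℝ) :
    iidMean p (n + 1) F = ∑ x, p x * iidMean p n (fun ω => F (Fin.cons x ω)) := by
  simp only [iidMean, Finset.mul_sum]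
  rw [← (Fin.consEquiv fun _ : Fin (n + 1) => X).sum_comp, Fintype.sum_prod_type]
  refine Finset.sum_congr rfl fun x _ => Finset.sum_congr rfl fun ω _ => ?_
  simp [Fin.consEquiv, Fin.prod_univ_succ, mul_assoc]

/-- The `k`-th moment of a sum of `n` independent copies of `Y`. -/
noncomputable def sumMoment (p Y : X → ℝ) (k n : ℕ) : ℝ :=
  iidMean p n fun ω => (∑ i, Y (ω i)) ^ k

theorem sumMoment_succ (Y : X → ℝ) (k n : ℕ) :
    sumMoment p Y k (n + 1) =
      ∑ j ∈ Finset.range (k + 1), (k.choose j : ℝ) * (∑ x, p x * Y x ^ j) *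
        sumMoment p Y (k - j) n := by
  have h (x : X) : iidMean p n (fun ω => (Y x + ∑ i, Y (ω i)) ^ k) =
      ∑ j ∈ Finset.range (k + 1), (k.choose j * Y x ^ j) * sumMoment p Y (k - j) n := by
    simp only [sumMoment, ← iidMean_const_mul, ← iidMean_sum]
    congr! 2 with ω
    rw [add_pow]
    exact Finset.sum_congr rfl fun j _ => by ring
  rw [sumMoment, iidMean_succ]
  simp only [Fin.sum_univ_succ, Fin.cons_zero, Fin.cons_succ, h, Finset.mul_sum, Finset.sum_mul]
  rw [Finset.sum_comm]
  exact Finset.sum_congr rfl fun j _ => Finset.sum_congr rfl fun x _ => by ring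

theorem sumMoment_zero_right (Y : X → ℝ) {k : ℕ} (hk : k ≠ 0) : sumMoment p Y k 0 = 0 := by
  simp [sumMoment, iidMean, hk]

theorem sumMoment_zero_left (hsum : ∑ x, p x = 1) (Y : X → ℝ) (n : ℕ) :
    sumMoment p Y 0 n = 1 := by
  simpa [sumMoment] using iidMean_one hsum n

theorem sumMoment_one {Y : X → ℝ} (hsum : ∑ x, p x = 1) (hmean : ∑ x, p x * Y x = 0)
    (n : ℕ) :
    sumMoment p Y 1 n = 0 := by
  induction n with
  | zero => simp [sumMoment_zero_right]
  | succ n ih =>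
    simp [sumMoment_succ, Finset.sum_range_succ, hsum, hmean, ih]

theorem sumMoment_two {Y : X → ℝ} (hsum : ∑ x, p x = 1) (hmean : ∑ x, p x * Y x = 0)
    (n : ℕ) :
    sumMoment p Y 2 n = (∑ x, p x * Y x ^ 2) * n := by
  induction n with
  | zero => simp [sumMoment_zero_right]
  | succ n ih =>
    simp [sumMoment_succ, Finset.sum_range_succ, hsum, hmean, ih, sumMoment_zero_left hsum]
    ring

theorem sumMoment_three {Y : X → ℝ} (hsum : ∑ x, p x = 1) (hmean : ∑ x, p x * Y x = 0)
    (n : ℕ) :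
    sumMoment p Y 3 n = (∑ x, p x * Y x ^ 3) * n := by
  induction n with
  | zero => simp [sumMoment_zero_right]
  | succ n ih =>
    simp [sumMoment_succ, Finset.sum_range_succ, hsum, hmean, ih, sumMoment_zero_left hsum,
      sumMoment_one hsum hmean]
    ring

theorem sumMoment_four {Y : X → ℝ} (hsum : ∑ x, p x = 1) (hmean : ∑ x, p x * Y x = 0)
    (n : ℕ) :
    sumMoment p Y 4 n =
      3 * (∑ x, p x * Y x ^ 2) ^ 2 * n * (n - 1) + (∑ x, p x * Y x ^ 4) * n := by
  induction n with
  | zero => simp [sumMoment_zero_right]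
  | succ n ih =>
    simp [sumMoment_succ, Finset.sum_range_succ, hsum, hmean, ih, sumMoment_zero_left hsum,
      sumMoment_one hsum hmean, sumMoment_two hsum hmean, Nat.choose]
    ring

theorem sumMoment_five {Y : X → ℝ} (hsum : ∑ x, p x = 1) (hmean : ∑ x, p x * Y x = 0)
    (n : ℕ) :
    sumMoment p Y 5 n =
      10 * (∑ x, p x * Y x ^ 2) * (∑ x, p x * Y x ^ 3) * n * (n - 1) +
        (∑ x, p x * Y x ^ 5) * n := by
  induction n with
  | zero => simp [sumMoment_zero_right]
  | succ n ih =>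
    simp [sumMoment_succ, Finset.sum_range_succ, hsum, hmean, ih, sumMoment_zero_left hsum,
      sumMoment_one hsum hmean, sumMoment_two hsum hmean, sumMoment_three hsum hmean, Nat.choose]
    ring

theorem sumMoment_six {Y : X → ℝ} (hsum : ∑ x, p x = 1) (hmean : ∑ x, p x * Y x = 0)
    (n : ℕ) :
    sumMoment p Y 6 n =
      15 * (∑ x, p x * Y x ^ 2) ^ 3 * n * (n - 1) * (n - 2) +
        (15 * (∑ x, p x * Y x ^ 2) * (∑ x, p x * Y x ^ 4) + 10 * (∑ x, p x * Y x ^ 3) ^ 2) *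
          n * (n - 1) +
        (∑ x, p x * Y x ^ 6) * n := by
  induction n with
  | zero => simp [sumMoment_zero_right]
  | succ n ih =>
    simp [sumMoment_succ, Finset.sum_range_succ, hsum, hmean, ih, sumMoment_zero_left hsum,
      sumMoment_one hsum hmean, sumMoment_two hsum hmean, sumMoment_three hsum hmean,
      sumMoment_four hsum hmean, Nat.choose]
    ring

end iidMean

/-- A uniform sixth-order Taylor bound for `log (1 + x)` away from the singularity. -/
theorem exists_abs_log_one_add_sub_le {a b : ℝ} (ha : 0 < a) :
    ∃ C, 0 ≤ C ∧ ∀ x, a ≤ 1 + x → 1 + x ≤ b →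
      |Real.log (1 + x) - (x - x ^ 2 / 2 + x ^ 3 / 3 - x ^ 4 / 4 + x ^ 5 / 5)| ≤ C * x ^ 6 := by
  have hcont : ContinuousOn
      (fun x => Real.log (1 + x) - (x - x ^ 2 / 2 + x ^ 3 / 3 - x ^ 4 / 4 + x ^ 5 / 5))
      (Set.Icc (a - 1) (b - 1)) := by
    refine ContinuousOn.sub (ContinuousOn.log (by fun_prop) fun x hx => ?_) (by fun_prop)
    linarith [hx.1]
  obtain ⟨B, hB⟩ := isCompact_Icc.exists_bound_of_continuousOn hcont
  refine ⟨2 + 64 * |B|, by positivity, fun x hax hxb => ?_⟩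
  have hx6 : 0 ≤ x ^ 6 := by positivity
  rcases le_total |x| (1 / 2) with hx | hx
  · have h := Real.abs_log_sub_add_sum_range_le (x := -x) (by rw [abs_neg]; linarith) 5
    rw [abs_neg, sub_neg_eq_add] at h
    have hpow : |x| ^ 6 = x ^ 6 := Even.pow_abs (by decide) x
    have hdiv : |x| ^ (5 + 1) / (1 - |x|) ≤ 2 * x ^ 6 := by
      rw [div_le_iff₀ (by linarith), hpow]
      nlinarith
    refine le_trans (le_of_eq ?_) (h.trans (hdiv.trans ?_))
    · congr 1
      simp only [Finset.sum_range_succ, Finset.sum_range_zero]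
      norm_num
      ring
    · nlinarith [mul_nonneg (abs_nonneg B) hx6]
  · have h := hB x ⟨by linarith, by linarith⟩
    have hpow : (1 / 2 : ℝ) ^ 6 ≤ x ^ 6 := by
      rw [← Even.pow_abs (n := 6) (by decide) x]
      gcongr
    rw [Real.norm_eq_abs] at h
    refine h.trans ((le_abs_self B).trans ?_)
    nlinarith [mul_le_mul_of_nonneg_left hpow (abs_nonneg B)]

/-- Second-order expansion of the bias of the logarithm of an empirical mean. -/
theorem iidMean_log_expansion {X : Type*} [Fintype X] [Nonempty X] {p Y : X → ℝ}
    (hp : ∀ x, 0 ≤ p x) (hsum : ∑ x, p x = 1) (hmean : ∑ x, p x * Y x = 0)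
    (hY : ∀ x, 0 < 1 + Y x) :
    ∃ c K : ℝ, 0 ≤ K ∧ ∀ n : ℕ, 0 < n →
      |iidMean p n (fun ω => Real.log (1 + (∑ i, Y (ω i)) / n)) +
        (∑ x, p x * Y x ^ 2) / (2 * n) - c / n ^ 2| ≤ K / n ^ 3 := by
  obtain ⟨x₀, hx₀⟩ := Finite.exists_min Y
  obtain ⟨x₁, hx₁⟩ := Finite.exists_max Y
  obtain ⟨C, hC0, hC⟩ := exists_abs_log_one_add_sub_le (b := 1 + Y x₁) (hY x₀)
  set v := ∑ x, p x * Y x ^ 2 with hv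
  set m₃ := ∑ x, p x * Y x ^ 3 with hm₃
  set m₄ := ∑ x, p x * Y x ^ 4 with hm₄
  set m₅ := ∑ x, p x * Y x ^ 5 with hm₅
  set m₆ := ∑ x, p x * Y x ^ 6 with hm₆
  have hv0 : 0 ≤ v := Finset.sum_nonneg fun x _ => mul_nonneg (hp x) (by positivity)
  have hm₄0 : 0 ≤ m₄ := Finset.sum_nonneg fun x _ => mul_nonneg (hp x) (by positivity)
  have hm₆0 : 0 ≤ m₆ := Finset.sum_nonneg fun x _ => mul_nonneg (hp x) (by positivity)
  refine ⟨m₃ / 3 - 3 * v ^ 2 / 4, (3 * v ^ 2 + m₄) + (10 * v * |m₃| + |m₅|) +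
    C * (15 * v ^ 3 + (15 * v * m₄ + 10 * m₃ ^ 2) + m₆), by positivity, fun n hn => ?_⟩
  have hn1 : (1 : ℝ) ≤ n := by exact_mod_cast hn
  have hn0 : (0 : ℝ) < n := by linarith
  have hrem := abs_iidMean_le (p := p) hp n
    (F := fun ω => Real.log (1 + (∑ i, Y (ω i)) / n) +
      ((-1 / n) * (∑ i, Y (ω i)) ^ 1 + ((1 / (2 * n ^ 2)) * (∑ i, Y (ω i)) ^ 2 +
      ((-1 / (3 * n ^ 3)) * (∑ i, Y (ω i)) ^ 3 + ((1 / (4 * n ^ 4)) * (∑ i, Y (ω i)) ^ 4 +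
        (-1 / (5 * n ^ 5)) * (∑ i, Y (ω i)) ^ 5)))))
    (G := fun ω => (C / n ^ 6) * (∑ i, Y (ω i)) ^ 6) fun ω => by
      have hlo : Y x₀ ≤ (∑ i, Y (ω i)) / n := by
        rw [le_div_iff₀ hn0]
        have := Finset.card_nsmul_le_sum Finset.univ (fun i => Y (ω i)) (Y x₀) fun i _ => hx₀ _
        simpa [mul_comm] using this
      have hhi : (∑ i, Y (ω i)) / n ≤ Y x₁ := by
        rw [div_le_iff₀ hn0]
        have := Finset.sum_le_card_nsmul Finset.univ (fun i => Y (ω i)) (Y x₁) fun i _ => hx₁ _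
        simpa [mul_comm] using this
      refine le_trans (le_of_eq ?_) ((hC ((∑ i, Y (ω i)) / n) (by linarith) (by linarith)).trans (le_of_eq ?_))
      · congr 1
        field_simp
        ring
      · field_simp
  simp only [iidMean_add, iidMean_const_mul] at hrem
  change |_ + (_ * sumMoment p Y 1 n + (_ * sumMoment p Y 2 n + (_ * sumMoment p Y 3 n +
    (_ * sumMoment p Y 4 n + _ * sumMoment p Y 5 n))))| ≤ _ * sumMoment p Y 6 n at hrem
  rw [sumMoment_one hsum hmean, sumMoment_two hsum hmean, sumMoment_three hsum hmean,
    sumMoment_four hsum hmean, sumMoment_five hsum hmean, sumMoment_six hsum hmean,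
    ← hv, ← hm₃, ← hm₄, ← hm₅, ← hm₆] at hrem
  set L := iidMean p n (fun ω => Real.log (1 + (∑ i, Y (ω i)) / n))
  set N : ℝ := (n : ℝ)
  have h₆ : C / N ^ 6 * (15 * v ^ 3 * N * (N - 1) * (N - 2) +
      (15 * v * m₄ + 10 * m₃ ^ 2) * N * (N - 1) + m₆ * N) ≤
      C * (15 * v ^ 3 + (15 * v * m₄ + 10 * m₃ ^ 2) + m₆) / N ^ 3 := by
    have h3 : N * (N - 1) * (N - 2) ≤ N ^ 3 := by nlinarith
    have h2 : N * (N - 1) ≤ N ^ 3 := by nlinarith [sq_nonneg (N - 1)]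
    have h1 : N ≤ N ^ 3 := by nlinarith [sq_nonneg (N - 1)]
    have : 15 * v ^ 3 * N * (N - 1) * (N - 2) +
      (15 * v * m₄ + 10 * m₃ ^ 2) * N * (N - 1) + m₆ * N ≤
      (15 * v ^ 3 + (15 * v * m₄ + 10 * m₃ ^ 2) + m₆) * N ^ 3 := by
      have e3 := mul_le_mul_of_nonneg_left h3 (show 0 ≤ 15 * v ^ 3 by positivity)
      have e2 := mul_le_mul_of_nonneg_left h2 (show 0 ≤ 15 * v * m₄ + 10 * m₃ ^ 2 by positivity)
      have e1 := mul_le_mul_of_nonneg_left h1 hm₆0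
      linarith
    refine (mul_le_mul_of_nonneg_left this (by positivity)).trans (le_of_eq ?_)
    field_simp
  have h₄ : |(m₄ - 3 * v ^ 2) / (4 * N ^ 3)| ≤ (3 * v ^ 2 + m₄) / N ^ 3 := by
    rw [abs_div, abs_of_pos (show 0 < 4 * N ^ 3 by positivity)]
    refine div_le_div₀ (by positivity) ?_ (by positivity) (by nlinarith [pow_pos hn0 3])
    rw [abs_le]
    constructor <;> nlinarith
  have h₅ : |(10 * v * m₃ * (N - 1) + m₅) / (5 * N ^ 4)| ≤ (10 * v * |m₃| + |m₅|) / N ^ 3 := by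
    rw [abs_div, abs_of_pos (show 0 < 5 * N ^ 4 by positivity),
      div_le_div_iff₀ (by positivity) (by positivity)]
    have hnum : |10 * v * m₃ * (N - 1) + m₅| ≤ (10 * v * |m₃| + |m₅|) * N := by
      refine (abs_add_le _ _).trans ?_
      rw [abs_mul, abs_mul, abs_of_nonneg (show 0 ≤ 10 * v by positivity),
        abs_of_nonneg (show 0 ≤ N - 1 by linarith)]
      nlinarith [mul_nonneg (abs_nonneg m₅) (sub_nonneg.2 hn1), mul_nonneg hv0 (abs_nonneg m₃)]
    have hQ : 0 ≤ (10 * v * |m₃| + |m₅|) * N ^ 4 := by positivity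
    calc _ ≤ (10 * v * |m₃| + |m₅|) * N * N ^ 3 := by gcongr
      _ ≤ _ := by linarith
  have hsplit : L + v / (2 * N) - (m₃ / 3 - 3 * v ^ 2 / 4) / N ^ 2 =
      (L + (-1 / N * 0 + (1 / (2 * N ^ 2) * (v * N) + (-1 / (3 * N ^ 3) * (m₃ * N) +
        (1 / (4 * N ^ 4) * (3 * v ^ 2 * N * (N - 1) + m₄ * N) +
          -1 / (5 * N ^ 5) * (10 * v * m₃ * N * (N - 1) + m₅ * N)))))) -
      (m₄ - 3 * v ^ 2) / (4 * N ^ 3) + (10 * v * m₃ * (N - 1) + m₅) / (5 * N ^ 4) := by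
    field_simp
    ring
  rw [hsplit]
  refine (abs_add_le _ _).trans ((add_le_add_left (abs_sub _ _) _).trans ?_)
  rw [add_div _ (C * _), add_div (3 * v ^ 2 + m₄)]
  linarith

/-- If `f n = -v / (2n) + c / n² + O(n⁻³)`, the combination `(2n-1) f n - 2(n-1) f (n-1)`
equals `v / (2n) + O(n⁻²)`. -/
theorem exists_abs_correction_sub_le {f : ℕ → ℝ} {v c K : ℝ} (hK : 0 ≤ K)
    (h : ∀ n : ℕ, 0 < n → |f n + v / (2 * n) - c / n ^ 2| ≤ K / n ^ 3) :
    ∀ n : ℕ, 1 < n →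
      |(2 * (n : ℝ) - 1) * f n - 2 * ((n : ℝ) - 1) * f (n - 1) - v / (2 * n)| ≤
        (6 * |c| + 10 * K) / n ^ 2 := by
  intro n hn
  obtain ⟨k, rfl⟩ : ∃ k, n = k + 1 := ⟨n - 1, by omega⟩
  have hk : (1 : ℝ) ≤ k := by exact_mod_cast (by omega : 1 ≤ k)
  have h1 := h (k + 1) (by omega)
  have h0 := h k (by omega)
  simp only [Nat.add_sub_cancel, Nat.cast_add, Nat.cast_one] at *
  set N : ℝ := (k : ℝ)
  set r₁ := f (k + 1) + v / (2 * (N + 1)) - c / (N + 1) ^ 2 with hr₁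
  set r₀ := f k + v / (2 * N) - c / N ^ 2 with hr₀
  have e : (2 * (N + 1) - 1) * f (k + 1) - 2 * (N + 1 - 1) * f k - v / (2 * (N + 1)) =
      -(c * ((3 * N + 2) / ((N + 1) ^ 2 * N))) + (2 * N + 1) * r₁ - 2 * N * r₀ := by
    rw [hr₁, hr₀]
    field_simp
    ring
  have hc : |c * ((3 * N + 2) / ((N + 1) ^ 2 * N))| ≤ 6 * |c| / (N + 1) ^ 2 := by
    rw [abs_mul, abs_of_pos (show 0 < (3 * N + 2) / ((N + 1) ^ 2 * N) by positivity)]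
    have : (3 * N + 2) / ((N + 1) ^ 2 * N) ≤ 6 / (N + 1) ^ 2 := by
      rw [div_le_div_iff₀ (by positivity) (by positivity)]
      nlinarith [mul_nonneg (sub_nonneg.2 hk) (sq_nonneg (N + 1))]
    calc _ ≤ |c| * (6 / (N + 1) ^ 2) := by gcongr
      _ = _ := by ring
  have hb₁ : |(2 * N + 1) * r₁| ≤ 2 * K / (N + 1) ^ 2 := by
    rw [abs_mul, abs_of_pos (by linarith)]
    calc _ ≤ (2 * (N + 1)) * (K / (N + 1) ^ 3) := by gcongr; linarith
      _ = _ := by field_simp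
  have hb₀ : |2 * N * r₀| ≤ 8 * K / (N + 1) ^ 2 := by
    rw [abs_mul, abs_of_pos (by linarith)]
    calc _ ≤ (2 * N) * (K / N ^ 3) := by gcongr
      _ = K * (2 / N ^ 2) := by field_simp
      _ ≤ K * (8 / (N + 1) ^ 2) := by
        gcongr ?_ * ?_
        rw [div_le_div_iff₀ (by positivity) (by positivity)]
        nlinarith
      _ = _ := by ring
  rw [e]
  refine (abs_sub _ _).trans ((add_le_add_left (abs_add_le _ _) _).trans ?_)
  rw [abs_neg, add_div (6 * |c|), show 10 * K = 2 * K + 8 * K by ring, add_div (2 * K)]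
  linarith

/-- Bounds on the expected lower estimator `T_n` and the
bias-corrected upper estimator `(2n-1) T_n - 2(n-1) T_{n-1}` of the
log-partition function `A = log μ` of a residual energy-based model. -/
theorem stmt0 {X : Type*} [Fintype X] [Nonempty X]
    (p : X → ℝ) (hp : ∀ x, 0 < p x) (hsum : ∑ x, p x = 1)
    (E : X → ℝ)
    (μ μ₂ A : ℝ)
    (hμ : μ = ∑ x, p x * Real.exp (-(E x)))
    (hμ₂ : μ₂ = (∑ x, p x * Real.exp (-(2 * E x))) - μ ^ 2)
    (hA : A = Real.log μ)
    (hvar : 0 < μ₂)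
    (ET : ℕ → ℝ)
    (hET : ∀ n : ℕ, 0 < n →
      ET n = ∑ ω : Fin n → X, (∏ i, p (ω i)) *
        Real.log ((1 / (n : ℝ)) * ∑ i, Real.exp (-(E (ω i))))) :
    ∀ ε > 0, ∃ N : ℕ, 0 < N ∧ ∀ n : ℕ, N < n →
      A - ε < ET n ∧ ET n < A ∧
      A < (2 * (n : ℝ) - 1) * ET n - 2 * ((n : ℝ) - 1) * ET (n - 1) ∧
      (2 * (n : ℝ) - 1) * ET n - 2 * ((n : ℝ) - 1) * ET (n - 1) < A + ε := by
  have hμ0 : 0 < μ := by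
    rw [hμ]
    exact Finset.sum_pos (fun x _ => mul_pos (hp x) (Real.exp_pos _)) Finset.univ_nonempty
  set Y : X → ℝ := fun x => Real.exp (-(E x)) / μ - 1 with hYdef
  have hY (x : X) : 0 < 1 + Y x := by
    simp only [hYdef, add_sub_cancel]
    exact div_pos (Real.exp_pos _) hμ0
  have hmean : ∑ x, p x * Y x = 0 := by
    simp only [hYdef, mul_sub, mul_one, Finset.sum_sub_distrib, hsum, ← mul_div_assoc,
      ← Finset.sum_div, ← hμ, div_self hμ0.ne', sub_self]
  have hv : ∑ x, p x * Y x ^ 2 = μ₂ / μ ^ 2 := by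
    have hx (x : X) : p x * Y x ^ 2 = p x * Real.exp (-(2 * E x)) / μ ^ 2 -
        2 * (p x * Real.exp (-(E x)) / μ) + p x := by
      rw [show -(2 * E x) = -(E x) + -(E x) by ring, Real.exp_add]
      simp only [hYdef]
      field_simp
      ring
    simp only [hx, Finset.sum_add_distrib, Finset.sum_sub_distrib, ← Finset.mul_sum,
      ← Finset.sum_div, hsum, ← hμ, hμ₂]
    field_simp
    ring
  obtain ⟨c, K, hK, hexp⟩ := iidMean_log_expansion (fun x => (hp x).le) hsum hmean hY
  rw [hv] at hexp
  set v := μ₂ / μ ^ 2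
  have hv0 : 0 < v := by positivity
  have hlog (n : ℕ) (hn : 0 < n) :
      iidMean p n (fun ω => Real.log (1 + (∑ i, Y (ω i)) / n)) = ET n - A := by
    have hn0 : (0 : ℝ) < n := by exact_mod_cast hn
    have hfun (ω : Fin n → X) : Real.log (1 + (∑ i, Y (ω i)) / n) =
        Real.log ((1 / (n : ℝ)) * ∑ i, Real.exp (-(E (ω i)))) + (-A) * 1 := by
      have : Nonempty (Fin n) := ⟨⟨0, hn⟩⟩
      have hpos : 0 < ∑ i, Real.exp (-(E (ω i))) :=
        Finset.sum_pos (fun i _ => Real.exp_pos _) Finset.univ_nonempty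
      rw [hA, mul_one, ← sub_eq_add_neg, ← Real.log_div (by positivity) hμ0.ne']
      congr 1
      simp only [hYdef, Finset.sum_sub_distrib, ← Finset.sum_div, Finset.sum_const,
        Finset.card_univ, Fintype.card_fin, nsmul_eq_mul, mul_one]
      field_simp
      ring
    simp only [hfun, iidMean_add, iidMean_const_mul, iidMean_one hsum, hET n hn]
    simp only [iidMean]
    ring
  have hexp' : ∀ n : ℕ, 0 < n →
      |(ET n - A) + v / (2 * n) - c / n ^ 2| ≤ K / n ^ 3 := fun n hn => by
    rw [← hlog n hn]; exact hexp n hn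
  have hcorr := exists_abs_correction_sub_le (f := fun n => ET n - A) hK hexp'
  intro ε hε
  set L := 6 * |c| + 10 * K
  have hL : 0 ≤ L := by positivity
  obtain ⟨N, hN⟩ := exists_nat_gt (2 * L / v + (v + L) / ε)
  refine ⟨N + 1, by omega, fun n hn => ?_⟩
  have hn1 : (1 : ℝ) ≤ n := by exact_mod_cast (by omega : 1 ≤ n)
  have hn0 : (0 : ℝ) < n := by linarith
  have hNn : (N : ℝ) < n := by exact_mod_cast (by omega : N < n)
  have hLv : L / n ^ 2 < v / (2 * n) := by
    have : 2 * L / v < n := by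
      have : 0 ≤ (v + L) / ε := by positivity
      linarith
    rw [div_lt_iff₀ hv0] at this
    rw [div_lt_div_iff₀ (by positivity) (by positivity)]
    nlinarith
  have hsmall : v / (2 * n) + L / n ^ 2 < ε := by
    have : (v + L) / ε < n := by
      have : 0 ≤ 2 * L / v := by positivity
      linarith
    rw [div_lt_iff₀ hε] at this
    have h1 : v / (2 * n) ≤ v / n := by gcongr; linarith
    have h2 : L / n ^ 2 ≤ L / n := by gcongr; nlinarith
    have h3 : (v + L) / n < ε := by rw [div_lt_iff₀ hn0]; linarith
    rw [add_div] at h3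
    linarith
  have hfirst : |(ET n - A) + v / (2 * n)| ≤ L / n ^ 2 := by
    have h := hexp' n (by omega)
    have hKn : K / n ^ 3 ≤ K / n ^ 2 := by gcongr; norm_num
    have hcn : |c / (n : ℝ) ^ 2| = |c| / n ^ 2 := by
      rw [abs_div, abs_of_pos (show (0 : ℝ) < n ^ 2 by positivity)]
    have hsum' : K / n ^ 2 + |c| / n ^ 2 ≤ L / (n : ℝ) ^ 2 := by
      rw [← add_div]
      gcongr
      simp only [L]
      linarith [abs_nonneg c]
    have := abs_sub_abs_le_abs_sub ((ET n - A) + v / (2 * n)) (c / (n : ℝ) ^ 2)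
    linarith
  have hsecond := hcorr n (by omega)
  rw [abs_le] at hfirst hsecond
  have hvn : 0 < v / (2 * n) := by positivity
  refine ⟨by linarith, by linarith, by linarith, by linarith⟩
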